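/- arXiv:2103.02634 — 2 statements merged into one kernel-verified Lean document; each statement's English description precedes it below -/
import Mathlib

section
/- Let H be a Hermitian matrix on a finite-dimensional complex Hilbert space with orthonormal eigenbasis {|j⟩}, non-degenerate spectrum and non-degenerate gaps. Then for every unit vector ψ and every Hermitian observable A, the temporal fluctuation satisfies ΔA^∞_ψ ≤ ‖A‖² · Σ_j |⟨j|ψ⟩|⁴, where ‖A‖ is the operator norm; in particular ΔA^∞_ψ = O(1/D_eff) with 1/D_eff := Σ_j |⟨j|ψ⟩|⁴. -/
open MeasureTheory Matrix
open scoped ComplexConjugate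

noncomputable section

/-- The Heisenberg-evolved expectation value `⟨ψ| e^{iHt} A e^{−iHt} |ψ⟩`. -/
def obsAt {ι : Type*} [Fintype ι] [DecidableEq ι] (H A : Matrix ι ι ℂ)
    (ψ : EuclideanSpace ℂ ι) (t : ℝ) : ℂ :=
  inner ℂ ψ ((Matrix.toEuclideanCLM (𝕜 := ℂ)
    (NormedSpace.exp (((t : ℂ) * Complex.I) • H) * A *
      NormedSpace.exp ((-(t : ℂ) * Complex.I) • H))) ψ)

/-- The time average `(1/T) ∫₀^T f` converges to `L` as `T → ∞` (complex-valued). -/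
def TimeAvgTendsto (f : ℝ → ℂ) (L : ℂ) : Prop :=
  Filter.Tendsto (fun T : ℝ => (T : ℂ)⁻¹ * ∫ t in Set.Ioc (0 : ℝ) T, f t)
    Filter.atTop (nhds L)

/-- The time average `(1/T) ∫₀^T g` converges to `L` as `T → ∞` (real-valued). -/
def TimeAvgTendstoR (g : ℝ → ℝ) (L : ℝ) : Prop :=
  Filter.Tendsto (fun T : ℝ => T⁻¹ * ∫ t in Set.Ioc (0 : ℝ) T, g t)
    Filter.atTop (nhds L)

lemma timeAvg_exp (w : ℝ) :
    TimeAvgTendsto (fun t => Complex.exp ((w * Complex.I) * t)) (if w = 0 then 1 else 0) := by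
  unfold TimeAvgTendsto
  split_ifs with h
  · refine tendsto_const_nhds.congr' ?_
    filter_upwards [Filter.eventually_gt_atTop (0 : ℝ)] with T hT
    have : (T : ℂ) ≠ 0 := by exact_mod_cast hT.ne'
    simp [h, hT.le, this]
  · have hc : (w : ℂ) * Complex.I ≠ 0 := by simp [h]
    have hb : Filter.Tendsto (fun T : ℝ => T⁻¹ * (2 / |w|)) Filter.atTop (nhds 0) := by
      simpa using tendsto_inv_atTop_zero.mul_const (2 / |w|)
    refine squeeze_zero_norm' ?_ hb
    filter_upwards [Filter.eventually_gt_atTop (0 : ℝ)] with T hT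
    rw [← intervalIntegral.integral_of_le hT.le, integral_exp_mul_complex hc, norm_mul, norm_div,
      norm_inv, Complex.norm_real, Real.norm_eq_abs, abs_of_pos hT, norm_mul, Complex.norm_I,
      mul_one, Complex.norm_real, Real.norm_eq_abs]
    gcongr
    refine (norm_sub_le _ _).trans ?_
    have e1 : ‖Complex.exp ((w : ℂ) * Complex.I * T)‖ = 1 := by
      have := Complex.norm_exp_ofReal_mul_I (w * T)
      rw [← this]; push_cast; ring_nf
    rw [e1]; simp; norm_num

lemma timeAvg_sum {κ : Type*} [Fintype κ] (a : κ → ℂ) (w : κ → ℝ) :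
    TimeAvgTendsto (fun t => ∑ p, a p * Complex.exp ((w p * Complex.I) * t))
      (∑ p, if w p = 0 then a p else 0) := by
  have h := tendsto_finsetSum Finset.univ (fun p _ => (timeAvg_exp (w p)).const_mul (a p))
  unfold TimeAvgTendsto
  convert h using 2 with T
  · rw [MeasureTheory.integral_finsetSum, Finset.mul_sum]
    · refine Finset.sum_congr rfl fun p _ => ?_
      rw [MeasureTheory.integral_const_mul]; ring
    · intro p _
      have : Continuous (fun t : ℝ => a p * Complex.exp ((w p * Complex.I) * t)) := by fun_prop
      exact this.integrableOn_Ioc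
  · simp

lemma timeAvgR_normSq {κ : Type*} [Fintype κ] [DecidableEq κ] (a : κ → ℂ) (w : κ → ℝ)
    (hw : ∀ p q, a p ≠ 0 → a q ≠ 0 → w p = w q → p = q) :
    TimeAvgTendstoR (fun t => ‖∑ p, a p * Complex.exp ((w p * Complex.I) * t)‖ ^ 2)
      (∑ p, ‖a p‖ ^ 2) := by
  have h := timeAvg_sum (κ := κ × κ) (fun x => a x.1 * conj (a x.2)) (fun x => w x.1 - w x.2)
  have e1 : (fun t : ℝ => ∑ x : κ × κ, a x.1 * conj (a x.2) *
      Complex.exp ((((w x.1 - w x.2 : ℝ) : ℂ) * Complex.I) * t)) =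
      fun t : ℝ => ((‖∑ p, a p * Complex.exp ((w p * Complex.I) * t)‖ ^ 2 : ℝ) : ℂ) := by
    funext t
    push_cast
    rw [← Complex.mul_conj', map_sum, Finset.sum_mul_sum, Fintype.sum_prod_type]
    refine Finset.sum_congr rfl fun p _ => Finset.sum_congr rfl fun q _ => ?_
    rw [map_mul, ← Complex.exp_conj]
    simp only [map_mul, Complex.conj_ofReal, Complex.conj_I]
    rw [mul_mul_mul_comm, ← Complex.exp_add]
    congr 2
    ring
  have e2 : (∑ x : κ × κ, if w x.1 - w x.2 = 0 then a x.1 * conj (a x.2) else 0) =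
      ((∑ p, ‖a p‖ ^ 2 : ℝ) : ℂ) := by
    rw [Fintype.sum_prod_type]
    push_cast
    refine Finset.sum_congr rfl fun p _ => ?_
    rw [Finset.sum_eq_single p]
    · simp [Complex.mul_conj']
    · intro q _ hq
      split_ifs with h0
      · by_contra hne
        have h1 : a p ≠ 0 := fun h => hne (by simp [h])
        have h2 : a q ≠ 0 := fun h => hne (by simp [h])
        exact hq (hw p q h1 h2 (sub_eq_zero.mp h0)).symm
      · rfl
    · simp
  rw [e1, e2] at h
  unfold TimeAvgTendsto at h
  unfold TimeAvgTendstoR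
  have h' := (Complex.continuous_re.tendsto _).comp h
  rw [Complex.ofReal_re] at h'
  refine h'.congr fun T => ?_
  simp only [Function.comp]
  rw [integral_complex_ofReal, ← Complex.ofReal_inv, ← Complex.ofReal_mul, Complex.ofReal_re]

lemma exp_apply_eigenvector {N : ℕ} (H : Matrix (Fin N) (Fin N) ℂ) (hH : H.IsHermitian)
    (z : ℂ) (j : Fin N) :
    Matrix.toEuclideanCLM (𝕜 := ℂ) (NormedSpace.exp (z • H)) (hH.eigenvectorBasis j) =
      Complex.exp (z * hH.eigenvalues j) • hH.eigenvectorBasis j := by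
  set U : Matrix (Fin N) (Fin N) ℂ := (hH.eigenvectorUnitary).1 with hU
  have h1 : U * star U = 1 := Unitary.coe_mul_star_self hH.eigenvectorUnitary
  have h2 : star U * U = 1 := Unitary.coe_star_mul_self hH.eigenvectorUnitary
  have hinv : U⁻¹ = star U := Matrix.inv_eq_right_inv h1
  have hunit : IsUnit U := ⟨⟨U, star U, h1, h2⟩, rfl⟩
  have hzH : z • H = U * diagonal (fun i => z * (hH.eigenvalues i : ℂ)) * U⁻¹ := by
    conv_lhs => rw [hH.spectral_theorem, Unitary.conjStarAlgAut_apply]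
    rw [hinv, hU, ← Matrix.smul_mul, ← Matrix.mul_smul, ← Matrix.diagonal_smul]
    rfl
  have hexp : NormedSpace.exp (z • H) * U = 
      U * diagonal (fun i => Complex.exp (z * (hH.eigenvalues i : ℂ))) := by
    rw [hzH, Matrix.exp_conj _ _ hunit, Matrix.exp_diagonal, hinv, mul_assoc, h2, mul_one]
    congr 2
    funext i
    rw [Pi.coe_exp, Complex.exp_eq_exp_ℂ]
  have hb : (hH.eigenvectorBasis j) = WithLp.toLp 2 (U *ᵥ Pi.single j 1) := by
    rw [hU, hH.eigenvectorUnitary_mulVec]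
  rw [hb, Matrix.toEuclideanCLM_toLp, Matrix.mulVec_mulVec, hexp, ← Matrix.mulVec_mulVec,
    Matrix.diagonal_mulVec_single, mul_one, ← WithLp.toLp_smul, ← Matrix.mulVec_smul]
  congr 2
  funext i
  by_cases h : i = j
  · subst h; simp
  · simp [h]

lemma obsAt_eq {N : ℕ} (H : Matrix (Fin N) (Fin N) ℂ) (hH : H.IsHermitian)
    (A : Matrix (Fin N) (Fin N) ℂ) (ψ : EuclideanSpace ℂ (Fin N)) (t : ℝ) :
    obsAt H A ψ t = ∑ p : Fin N × Fin N,
      (conj (inner ℂ (hH.eigenvectorBasis p.1) ψ : ℂ) * inner ℂ (hH.eigenvectorBasis p.2) ψ *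
        inner ℂ (hH.eigenvectorBasis p.1)
          (Matrix.toEuclideanCLM (𝕜 := ℂ) A (hH.eigenvectorBasis p.2))) *
      Complex.exp ((((hH.eigenvalues p.1 - hH.eigenvalues p.2 : ℝ) : ℂ) * Complex.I) * t) := by
  set b := hH.eigenvectorBasis with hb
  set V := NormedSpace.exp ((-(t : ℂ) * Complex.I) • H) with hV
  have hstar : NormedSpace.exp (((t : ℂ) * Complex.I) • H) = star V := by
    rw [hV, Matrix.star_eq_conjTranspose, ← Matrix.exp_conjTranspose, Matrix.conjTranspose_smul,
      hH.eq]
    simp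
  have hVψ : Matrix.toEuclideanCLM (𝕜 := ℂ) V ψ =
      ∑ j, ((inner ℂ (b j) ψ : ℂ) * Complex.exp (-(t : ℂ) * Complex.I * hH.eigenvalues j)) • b j := by
    conv_lhs => rw [← b.sum_repr' ψ]
    rw [map_sum]
    refine Finset.sum_congr rfl fun j _ => ?_
    rw [map_smul, hV, hb, exp_apply_eigenvector, smul_smul]
  unfold obsAt
  rw [hstar, map_mul, map_mul, map_star, ContinuousLinearMap.star_eq_adjoint]
  simp only [mul_apply_eq_comp]
  rw [ContinuousLinearMap.adjoint_inner_right, hVψ, map_sum, sum_inner, Fintype.sum_prod_type]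
  refine Finset.sum_congr rfl fun j _ => ?_
  rw [inner_sum]
  refine Finset.sum_congr rfl fun k _ => ?_
  rw [map_smul, inner_smul_left, inner_smul_right, map_mul, ← Complex.exp_conj]
  simp only [map_mul, map_neg, Complex.conj_ofReal, Complex.conj_I]
  have : Complex.exp ((((hH.eigenvalues j - hH.eigenvalues k : ℝ) : ℂ) * Complex.I) * t) =
      Complex.exp (-(t : ℂ) * -Complex.I * hH.eigenvalues j) *
      Complex.exp (-(t : ℂ) * Complex.I * hH.eigenvalues k) := by
    rw [← Complex.exp_add]; congr 1; push_cast; ring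
  rw [this]
  ring

lemma final_bound {N : ℕ} {E : Type*} [NormedAddCommGroup E] [InnerProductSpace ℂ E]
    [CompleteSpace E] (b : OrthonormalBasis (Fin N) ℂ E) (T : E →L[ℂ] E) (x : Fin N → ℝ) :
    ∑ j, ∑ k, x j * x k * ‖(inner ℂ (b j) (T (b k)) : ℂ)‖ ^ 2 ≤ ‖T‖ ^ 2 * ∑ j, x j ^ 2 := by
  have hcol : ∀ k, ∑ j, ‖(inner ℂ (b j) (T (b k)) : ℂ)‖ ^ 2 ≤ ‖T‖ ^ 2 := by
    intro k
    rw [b.sum_sq_norm_inner_right]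
    have := T.le_opNorm (b k)
    rw [b.orthonormal.1 k, mul_one] at this
    gcongr
  have hrow : ∀ j, ∑ k, ‖(inner ℂ (b j) (T (b k)) : ℂ)‖ ^ 2 ≤ ‖T‖ ^ 2 := by
    intro j
    simp_rw [← ContinuousLinearMap.adjoint_inner_left]
    rw [b.sum_sq_norm_inner_left]
    have := (ContinuousLinearMap.adjoint T).le_opNorm (b j)
    rw [b.orthonormal.1 j, mul_one, LinearIsometryEquiv.norm_map] at this
    gcongr
  set m : Fin N → Fin N → ℝ := fun j k => ‖(inner ℂ (b j) (T (b k)) : ℂ)‖ ^ 2 with hm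
  have hm0 : ∀ j k, 0 ≤ m j k := fun j k => by positivity
  calc ∑ j, ∑ k, x j * x k * m j k
      ≤ ∑ j, ∑ k, (x j ^ 2 / 2 * m j k + x k ^ 2 / 2 * m j k) := by
        refine Finset.sum_le_sum fun j _ => Finset.sum_le_sum fun k _ => ?_
        nlinarith [mul_nonneg (sq_nonneg (x j - x k)) (hm0 j k)]
    _ = ∑ j, x j ^ 2 / 2 * ∑ k, m j k + ∑ k, x k ^ 2 / 2 * ∑ j, m j k := by
        simp_rw [Finset.sum_add_distrib, Finset.mul_sum]
        congr 1
        exact Finset.sum_comm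
    _ ≤ ∑ j, x j ^ 2 / 2 * ‖T‖ ^ 2 + ∑ k, x k ^ 2 / 2 * ‖T‖ ^ 2 := by
        gcongr with j _ k _
        · exact hrow j
        · exact hcol k
    _ = ‖T‖ ^ 2 * ∑ j, x j ^ 2 := by
        rw [← Finset.sum_add_distrib, Finset.mul_sum]
        exact Finset.sum_congr rfl fun j _ => by ring

/-- equilibration bound via the effective dimension.  Let `H` be a Hermitian
matrix with non-degenerate spectrum and non-degenerate gaps, and `ψ` a unit vector, `A`
a Hermitian observable.  Then the infinite-time average `A^∞_ψ` and the temporal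
fluctuation `ΔA^∞_ψ` exist, and `ΔA^∞_ψ ≤ ‖A‖² Σ_j |⟨j|ψ⟩|⁴` where `‖A‖` is the
operator norm and `{|j⟩}` the orthonormal eigenbasis of `H`; in particular
`ΔA^∞_ψ = O(1/D_eff)` with `1/D_eff := Σ_j |⟨j|ψ⟩|⁴`. -/
theorem fluctuation_bound_effective_dimension
    {N : ℕ} (H : Matrix (Fin N) (Fin N) ℂ) (hH : H.IsHermitian)
    (hspec : Function.Injective hH.eigenvalues)
    (hgaps : ∀ j k l m : Fin N, j ≠ k → l ≠ m →
      hH.eigenvalues j - hH.eigenvalues k = hH.eigenvalues l - hH.eigenvalues m →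
      j = l ∧ k = m)
    (A : Matrix (Fin N) (Fin N) ℂ) (hA : A.IsHermitian)
    (ψ : EuclideanSpace ℂ (Fin N)) (hψ : ‖ψ‖ = 1) :
    ∃ (Ainf : ℂ) (Δ : ℝ),
      TimeAvgTendsto (obsAt H A ψ) Ainf ∧
      TimeAvgTendstoR (fun t => ‖obsAt H A ψ t - Ainf‖ ^ 2) Δ ∧
      Δ ≤ ‖Matrix.toEuclideanCLM (𝕜 := ℂ) A‖ ^ 2 *
        ∑ j, ‖(inner ℂ (hH.eigenvectorBasis j) ψ : ℂ)‖ ^ 4 := by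
  set b := hH.eigenvectorBasis with hb
  set a : Fin N × Fin N → ℂ := fun p =>
    conj (inner ℂ (b p.1) ψ : ℂ) * inner ℂ (b p.2) ψ *
      inner ℂ (b p.1) (Matrix.toEuclideanCLM (𝕜 := ℂ) A (b p.2)) with ha
  set w : Fin N × Fin N → ℝ := fun p => hH.eigenvalues p.1 - hH.eigenvalues p.2 with hw
  have hobs : obsAt H A ψ = fun t : ℝ => ∑ p, a p * Complex.exp ((w p * Complex.I) * t) := by
    funext t
    exact obsAt_eq H hH A ψ t
  set a' : Fin N × Fin N → ℂ := fun p => if w p = 0 then 0 else a p with ha'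
  refine ⟨∑ p, if w p = 0 then a p else 0, ∑ p, ‖a' p‖ ^ 2, ?_, ?_, ?_⟩
  · rw [hobs]
    exact timeAvg_sum a w
  · have hdiff : ∀ t : ℝ, obsAt H A ψ t - (∑ p, if w p = 0 then a p else 0) =
        ∑ p, a' p * Complex.exp ((w p * Complex.I) * t) := by
      intro t
      rw [hobs]
      simp only
      rw [← Finset.sum_sub_distrib]
      refine Finset.sum_congr rfl fun p _ => ?_
      by_cases h : w p = 0
      · simp [ha', h]
      · simp [ha', h]
    simp_rw [hdiff]
    refine timeAvgR_normSq a' w ?_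
    intro p q hp hq hpq
    have aux : ∀ r, a' r ≠ 0 → r.1 ≠ r.2 := by
      intro r hr he
      apply hr
      simp [ha', hw, he]
    obtain ⟨h1, h2⟩ := hgaps p.1 p.2 q.1 q.2 (aux p hp) (aux q hq) hpq
    exact Prod.ext h1 h2
  · have h := final_bound b (Matrix.toEuclideanCLM (𝕜 := ℂ) A)
      (fun j => ‖(inner ℂ (b j) ψ : ℂ)‖ ^ 2)
    calc ∑ p, ‖a' p‖ ^ 2 ≤ ∑ p, ‖a p‖ ^ 2 := by
          refine Finset.sum_le_sum fun p _ => ?_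
          by_cases h : w p = 0
          · simp [ha', h]
          · simp [ha', h]
      _ = _ := by
          rw [Fintype.sum_prod_type]
          refine Finset.sum_congr rfl fun j _ => Finset.sum_congr rfl fun k _ => ?_
          simp only [ha, norm_mul, RCLike.norm_conj, mul_pow]

      _ ≤ _ := h
      _ = _ := by simp_rw [← pow_mul]
end
end

section
/- Fix integers d ≥ 2, D ≥ 2 and set α(d,D) := log( (d − 1/(dD²)) / ((1 + 1/D)(1 + 1/(dD))) ). For every orthonormal basis {φ_j} of (ℂ^d)^{⊗n}, the expected inverse effective dimension of a random matrix product state satisfies E_{ψ ∼ μ_{d,n,D}} Σ_j |⟨ψ|φ_j⟩|⁴ ≤ 2 e^{−α(d,D) n}. -/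
open MeasureTheory Matrix
open scoped ComplexConjugate

noncomputable section

instance matrixMeasurableSpace {m n : Type*} : MeasurableSpace (Matrix m n ℂ) :=
  MeasurableSpace.pi

/-- The site tensor `A^{(m)}_i = (⟨i| ⊗ 1_D) U (|0⟩ ⊗ 1_D)`. -/
def siteMat (d D : ℕ) [NeZero d] (U : Matrix.unitaryGroup (Fin d × Fin D) ℂ) (i : Fin d) :
    Matrix (Fin D) (Fin D) ℂ :=
  Matrix.of fun a b => (U : Matrix (Fin d × Fin D) (Fin d × Fin D) ℂ) (i, a) (0, b)

/-- The (unnormalized) matrix product state `ψ`, with periodic boundary conditions: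
`ψ(i₁,…,iₙ) = Tr[A^{(1)}_{i₁} ⋯ A^{(n)}_{iₙ}]`. -/
def mps (d D n : ℕ) [NeZero d] (U : Fin n → Matrix.unitaryGroup (Fin d × Fin D) ℂ) :
    (Fin n → Fin d) → ℂ :=
  fun idx => Matrix.trace (((List.finRange n).map fun m => siteMat d D (U m) (idx m)).prod)
/-- The random MPS as an element of the Euclidean (ℓ²) space `(ℂ^d)^{⊗n}`. -/
def mpsE (d D n : ℕ) [NeZero d] (U : Fin n → Matrix.unitaryGroup (Fin d × Fin D) ℂ) :
    EuclideanSpace ℂ (Fin n → Fin d) :=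
  (WithLp.equiv 2 ((Fin n → Fin d) → ℂ)).symm (mps d D n U)


section moment
variable {κ : Type*} [Fintype κ] [DecidableEq κ]

lemma entry_measurable (x b : κ) :
    Measurable (fun U : Matrix.unitaryGroup κ ℂ => (U : Matrix κ κ ℂ) x b) := by
  have h1 : Measurable (fun U : Matrix.unitaryGroup κ ℂ => (U : Matrix κ κ ℂ)) :=
    measurable_subtype_coe
  exact (measurable_pi_apply b).comp ((measurable_pi_apply x).comp h1)

/-- the quartic monomial -/
def quart (b b' c c' x y z w : κ) (U : Matrix.unitaryGroup κ ℂ) : ℂ :=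
  (U : Matrix κ κ ℂ) x b * (U : Matrix κ κ ℂ) y b' *
    (conj ((U : Matrix κ κ ℂ) z c) * conj ((U : Matrix κ κ ℂ) w c'))

lemma quart_measurable (b b' c c' x y z w : κ) : Measurable (quart b b' c c' x y z w) := by
  have hc : Measurable (fun z : ℂ => conj z) := Complex.continuous_conj.measurable
  exact ((entry_measurable x b).mul (entry_measurable y b')).mul
    ((hc.comp (entry_measurable z c)).mul (hc.comp (entry_measurable w c')))

lemma quart_bound (b b' c c' x y z w : κ) (U : Matrix.unitaryGroup κ ℂ) :
    ‖quart b b' c c' x y z w U‖ ≤ 1 := by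
  have h : ∀ x b, ‖(U : Matrix κ κ ℂ) x b‖ ≤ 1 := fun x b => entry_norm_bound_of_unitary U.2 x b
  unfold quart
  rw [norm_mul, norm_mul, norm_mul, RCLike.norm_conj, RCLike.norm_conj]
  have := mul_le_one₀ (h x b) (norm_nonneg _) (h y b')
  have h2 := mul_le_one₀ (h z c) (norm_nonneg _) (h w c')
  exact mul_le_one₀ this (by positivity) h2

variable (μ : Measure (Matrix.unitaryGroup κ ℂ)) [IsProbabilityMeasure μ]

lemma quart_integrable (b b' c c' x y z w : κ) : Integrable (quart b b' c c' x y z w) μ :=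
  Integrable.of_bound (quart_measurable b b' c c' x y z w).aestronglyMeasurable 1
    (Filter.Eventually.of_forall (quart_bound b b' c c' x y z w))

/-- the fourth moment -/
def mom (b b' c c' x y z w : κ) : ℂ := ∫ U, quart b b' c c' x y z w U ∂μ

variable {μ}

lemma mom_inv
    (hHaar : ∀ V : Matrix.unitaryGroup κ ℂ, μ.map (fun U => V * U) = μ)
    (V : Matrix.unitaryGroup κ ℂ) (b b' c c' x y z w : κ) :
    mom μ b b' c c' x y z w = ∫ U, quart b b' c c' x y z w (V * U) ∂μ := by
  have hm : AEMeasurable (fun U => V * U) μ := by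
    have : NeZero (μ.map (fun U => V * U)) := by
      rw [hHaar V]; exact ⟨IsProbabilityMeasure.ne_zero μ⟩
    exact aemeasurable_of_map_neZero inferInstance
  unfold mom
  conv_lhs => rw [← hHaar V]
  rw [integral_map hm]
  exact (quart_measurable b b' c c' x y z w).aestronglyMeasurable

lemma mom_phase
    (hHaar : ∀ V : Matrix.unitaryGroup κ ℂ, μ.map (fun U => V * U) = μ)
    (e : κ) (b b' c c' x y z w : κ) :
    mom μ b b' c c' x y z w =
      ((if x = e then Complex.I else 1) * (if y = e then Complex.I else 1) *
      ((if z = e then -Complex.I else 1) * (if w = e then -Complex.I else 1))) *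
       mom μ b b' c c' x y z w := by
  let V : Matrix.unitaryGroup κ ℂ := ⟨Matrix.diagonal fun i => if i = e then Complex.I else 1, by
    rw [Matrix.mem_unitaryGroup_iff, Matrix.star_eq_conjTranspose, Matrix.diagonal_conjTranspose,
      Matrix.diagonal_mul_diagonal, ← Matrix.diagonal_one]
    congr 1
    ext i
    by_cases h : i = e <;> simp [h]⟩
  have hV : ∀ (U : Matrix.unitaryGroup κ ℂ) i j, ((V * U : Matrix.unitaryGroup κ ℂ) : Matrix κ κ ℂ) i j =
      (if i = e then Complex.I else 1) * (U : Matrix κ κ ℂ) i j := by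
    intro U i j
    simp [V, Matrix.diagonal_mul]
  conv_lhs => rw [mom_inv hHaar V]
  unfold mom
  rw [← integral_const_mul]
  congr 1
  ext U
  unfold quart
  simp only [hV, map_mul, apply_ite conj, Complex.conj_I, map_one]
  ring

lemma mom_zero
    (hHaar : ∀ V : Matrix.unitaryGroup κ ℂ, μ.map (fun U => V * U) = μ)
    (b b' c c' x y z w : κ) (h : ¬ ((x = z ∧ y = w) ∨ (x = w ∧ y = z))) :
    mom μ b b' c c' x y z w = 0 := by
  have h1 := mom_phase hHaar x b b' c c' x y z w
  have h2 := mom_phase hHaar y b b' c c' x y z w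
  have h3 := mom_phase hHaar z b b' c c' x y z w
  have h4 := mom_phase hHaar w b b' c c' x y z w
  by_contra hne
  have key : ∀ t : ℂ, mom μ b b' c c' x y z w = t * mom μ b b' c c' x y z w → t = 1 := by
    intro t ht
    exact mul_right_cancel₀ hne (by rw [one_mul]; exact ht.symm)
  replace h1 := key _ h1
  replace h2 := key _ h2
  replace h3 := key _ h3
  replace h4 := key _ h4
  clear key
  have i1 : Complex.I ≠ 1 := by intro h; simpa using congrArg Complex.re h
  have i2 : -Complex.I ≠ 1 := by intro h; simpa using congrArg Complex.re h
  have i3 : (-1 : ℂ) ≠ 1 := by norm_num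
  have ii : Complex.I * Complex.I = -1 := Complex.I_mul_I
  clear hne hHaar
  generalize Complex.I = t at *
  grind

lemma mom_perm
    (hHaar : ∀ V : Matrix.unitaryGroup κ ℂ, μ.map (fun U => V * U) = μ)
    (π : Equiv.Perm κ) (b b' c c' x y z w : κ) :
    mom μ b b' c c' x y z w = mom μ b b' c c' (π x) (π y) (π z) (π w) := by
  let V : Matrix.unitaryGroup κ ℂ := ⟨(π.toPEquiv.toMatrix : Matrix κ κ ℂ), by
    rw [Matrix.mem_unitaryGroup_iff, Matrix.star_eq_conjTranspose]
    ext i j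
    rw [PEquiv.toMatrix_toPEquiv_mul]
    simp [Matrix.conjTranspose_apply, PEquiv.toMatrix_apply, Matrix.one_apply, eq_comm]⟩
  have hV : ∀ (U : Matrix.unitaryGroup κ ℂ) i j, ((V * U : Matrix.unitaryGroup κ ℂ) : Matrix κ κ ℂ) i j =
      (U : Matrix κ κ ℂ) (π i) j := by
    intro U i j
    simp [V, PEquiv.toMatrix_toPEquiv_mul]
  rw [mom_inv hHaar V]
  unfold mom quart
  simp only [hV]

lemma mom_rot
    (hHaar : ∀ V : Matrix.unitaryGroup κ ℂ, μ.map (fun U => V * U) = μ)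
    (x y : κ) (hxy : x ≠ y) (b b' c c' : κ) :
    mom μ b b' c c' x x x x = ∑ i : Bool, ∑ j : Bool, ∑ k : Bool, ∑ l : Bool,
      ((bif i then 3/5 else 4/5) * (bif j then 3/5 else 4/5) * ((bif k then 3/5 else 4/5) *
        (bif l then 3/5 else 4/5))) *
       mom μ b b' c c' (bif i then x else y) (bif j then x else y) (bif k then x else y)
        (bif l then x else y) := by
  let P : Matrix κ κ ℂ := Matrix.single x x 1 + Matrix.single y y 1
  let J : Matrix κ κ ℂ := Matrix.single x y 1 - Matrix.single y x 1
  have hP : P * P = P := by simp [P, add_mul, mul_add, hxy, hxy.symm]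
  have hPJ : P * J = J := by simp [P, J, add_mul, mul_add, mul_sub, hxy, hxy.symm, sub_eq_add_neg]
  have hJP : J * P = J := by
    simp [P, J, add_mul, mul_add, hxy, hxy.symm, sub_eq_add_neg]
    abel
  have hJ : J * J = -P := by
    simp [P, J, add_mul, mul_add, hxy, hxy.symm, sub_eq_add_neg, add_comm]
  let V : Matrix.unitaryGroup κ ℂ := ⟨1 - (2/5 : ℂ) • P + (4/5 : ℂ) • J, by
    have hs : star (1 - (2/5 : ℂ) • P + (4/5 : ℂ) • J) = 1 - (2/5 : ℂ) • P - (4/5 : ℂ) • J := by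
      have e1 : star P = P := by simp [P, Matrix.star_eq_conjTranspose]
      have e2 : star J = -J := by simp [J, Matrix.star_eq_conjTranspose]
      rw [star_add, star_sub, star_smul, star_smul, e1, e2, star_one]
      simp [sub_eq_add_neg]
    rw [Matrix.mem_unitaryGroup_iff, hs]
    simp only [add_mul, sub_mul, mul_add, mul_sub, one_mul, mul_one, smul_mul_assoc,
      mul_smul_comm, hP, hPJ, hJP, hJ]
    module⟩
  have hV : ∀ (U : Matrix.unitaryGroup κ ℂ) j, ((V * U : Matrix.unitaryGroup κ ℂ) : Matrix κ κ ℂ) x j =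
      3/5 * (U : Matrix κ κ ℂ) x j + 4/5 * (U : Matrix κ κ ℂ) y j := by
    intro U j
    simp [V, P, J, add_mul, sub_mul, hxy, hxy.symm]
    ring
  conv_lhs => rw [mom_inv hHaar V]
  unfold mom
  simp only [← integral_const_mul]
  have hi : ∀ i j k l : Bool, Integrable (fun U => 
     ((bif i then 3/5 else 4/5) * (bif j then 3/5 else 4/5) * ((bif k then 3/5 else 4/5) *
        (bif l then 3/5 else 4/5))) *
       quart b b' c c' (bif i then x else y) (bif j then x else y) (bif k then x else y)
        (bif l then x else y) U) μ := fun i j k l => (quart_integrable μ _ _ _ _ _ _ _ _).const_mul _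
  simp only [Fintype.sum_bool]
  rw [← integral_add, ← integral_add, ← integral_add, ← integral_add, ← integral_add, 
    ← integral_add, ← integral_add, ← integral_add, ← integral_add, ← integral_add, 
    ← integral_add, ← integral_add, ← integral_add, ← integral_add, ← integral_add]
  · congr 1
    ext U
    unfold quart
    simp only [hV, map_add, map_mul, cond_true, cond_false, map_div₀, map_ofNat]
    ring
  all_goals 
    repeat' apply Integrable.add
    all_goals apply hi

lemma exists_perm (x y x0 y0 : κ) (h : x ≠ y) (h0 : x0 ≠ y0) :
    ∃ π : Equiv.Perm κ, π x = x0 ∧ π y = y0 := by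
  refine ⟨Equiv.swap (Equiv.swap x x0 y) y0 * Equiv.swap x x0, ?_, ?_⟩
  · have h1 : x0 ≠ Equiv.swap x x0 y := by
      intro h2
      have := congrArg (Equiv.swap x x0) h2
      simp at this
      exact h this
    simp [Equiv.swap_apply_of_ne_of_ne h1 h0]
  · simp

/-- pairing indicator -/
def del {κ : Type*} [DecidableEq κ] (σ : Bool) (x y z w : κ) : ℂ :=
  bif σ then (if x = w then 1 else 0) * (if y = z then 1 else 0)
  else (if x = z then 1 else 0) * (if y = w then 1 else 0)

/-- Weingarten function -/
def wg (q : ℝ) (σ τ : Bool) : ℝ := if σ = τ then 1 / (q ^ 2 - 1) else -1 / (q * (q ^ 2 - 1))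

lemma mom_AB
    (hHaar : ∀ V : Matrix.unitaryGroup κ ℂ, μ.map (fun U => V * U) = μ)
    (x0 y0 : κ) (h0 : x0 ≠ y0) (b b' c c' x y z w : κ) :
    mom μ b b' c c' x y z w = del false x y z w * mom μ b b' c c' x0 y0 x0 y0 +
      del true x y z w * mom μ b b' c c' x0 y0 y0 x0 := by
  have hA : ∀ x y, x ≠ y → mom μ b b' c c' x y x y = mom μ b b' c c' x0 y0 x0 y0 := by
    intro x y h
    obtain ⟨π, h1, h2⟩ := exists_perm x y x0 y0 h h0
    rw [mom_perm hHaar π, h1, h2]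
  have hB : ∀ x y, x ≠ y → mom μ b b' c c' x y y x = mom μ b b' c c' x0 y0 y0 x0 := by
    intro x y h
    obtain ⟨π, h1, h2⟩ := exists_perm x y x0 y0 h h0
    rw [mom_perm hHaar π, h1, h2]
  have hC : ∀ x y, x ≠ y → mom μ b b' c c' x x x x = mom μ b b' c c' y y y y := by
    intro x y h
    rw [mom_perm hHaar (Equiv.swap x y)]
    simp
  by_cases h : (x = z ∧ y = w) ∨ (x = w ∧ y = z)
  · by_cases hxy : x = y
    · have hz : x = z := by grind
      have hw : x = w := by grind
      subst hxy hz hw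
      obtain ⟨y, hy⟩ : ∃ y, x ≠ y := by
        by_cases hx : x = x0
        · exact ⟨y0, hx ▸ h0⟩
        · exact ⟨x0, hx⟩
      have hr := mom_rot hHaar x y hy b b' c c'
      simp only [Fintype.sum_bool, cond_true, cond_false] at hr
      rw [mom_zero hHaar b b' c c' x x x y (by grind), mom_zero hHaar b b' c c' x x y x (by grind),
        mom_zero hHaar b b' c c' x y x x (by grind), mom_zero hHaar b b' c c' y x x x (by grind),
        mom_zero hHaar b b' c c' y y y x (by grind), mom_zero hHaar b b' c c' y y x y (by grind),
        mom_zero hHaar b b' c c' y x y y (by grind), mom_zero hHaar b b' c c' x y y y (by grind),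
        mom_zero hHaar b b' c c' x x y y (by grind), mom_zero hHaar b b' c c' y y x x (by grind),
        hA x y hy, hA y x hy.symm, hB x y hy, hB y x hy.symm, ← hC x y hy] at hr
      simp only [del, cond_true, cond_false, if_true]
      linear_combination (625 / 288 : ℂ) * hr
    · rcases h with ⟨rfl, rfl⟩ | ⟨rfl, rfl⟩
      · rw [hA x y hxy]; simp [del, hxy]
      · rw [hB x y hxy]; simp [del, hxy]
  · rw [mom_zero hHaar _ _ _ _ _ _ _ _ h]
    have e1 : del false x y z w = 0 := by
      simp only [del, cond_false]; grind
    have e2 : del true x y z w = 0 := by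
      simp only [del, cond_true]; grind
    rw [e1, e2]; simp

lemma unit_sum (U : Matrix.unitaryGroup κ ℂ) (b c : κ) :
    ∑ x, (U : Matrix κ κ ℂ) x b * conj ((U : Matrix κ κ ℂ) x c) = if b = c then 1 else 0 := by
  have h := Matrix.mem_unitaryGroup_iff'.1 U.2
  have h2 := congrFun (congrFun h c) b
  rw [Matrix.mul_apply, Matrix.one_apply] at h2
  simp only [Matrix.star_apply, eq_comm (a := c)] at h2
  rw [← h2]
  exact Finset.sum_congr rfl fun x _ => mul_comm _ _

lemma sum_false (b b' c c' : κ) :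
    ∑ x, ∑ y, mom μ b b' c c' x y x y = del false b b' c c' := by
  unfold mom
  simp_rw [← integral_finsetSum _ (fun y _ => quart_integrable μ b b' c c' _ y _ y)]
  rw [← integral_finsetSum _ (fun x _ => integrable_finsetSum _ 
    (fun y _ => quart_integrable μ b b' c c' x y x y))]
  have : ∀ U : Matrix.unitaryGroup κ ℂ, ∑ x, ∑ y, quart b b' c c' x y x y U = del false b b' c c' := by
    intro U
    simp only [del, cond_false, ← unit_sum U, Finset.sum_mul_sum]
    refine Finset.sum_congr rfl fun x _ => Finset.sum_congr rfl fun y _ => ?_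
    unfold quart; ring
  simp [this]

lemma sum_true (b b' c c' : κ) :
    ∑ x, ∑ y, mom μ b b' c c' x y y x = del true b b' c c' := by
  unfold mom
  simp_rw [← integral_finsetSum _ (fun y _ => quart_integrable μ b b' c c' _ y y _)]
  rw [← integral_finsetSum _ (fun x _ => integrable_finsetSum _ 
    (fun y _ => quart_integrable μ b b' c c' x y y x))]
  have : ∀ U : Matrix.unitaryGroup κ ℂ, ∑ x, ∑ y, quart b b' c c' x y y x U = del true b b' c c' := by
    intro U
    simp only [del, cond_true, ← unit_sum U, Finset.sum_mul_sum]
    refine Finset.sum_congr rfl fun x _ => Finset.sum_congr rfl fun y _ => ?_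
    unfold quart; ring
  simp [this]

lemma mom_formula
    (hHaar : ∀ V : Matrix.unitaryGroup κ ℂ, μ.map (fun U => V * U) = μ)
    (hq : 2 ≤ Fintype.card κ) (b b' c c' x y z w : κ) :
    mom μ b b' c c' x y z w = ∑ σ : Bool, del σ x y z w *
      ∑ τ : Bool, (wg (Fintype.card κ) σ τ : ℂ) * del τ b b' c c' := by
  obtain ⟨x0, y0, h0⟩ := Fintype.exists_pair_of_one_lt_card (α := κ) (by omega)
  obtain ⟨A, B, hAB⟩ : ∃ A B : ℂ, ∀ x y z w, mom μ b b' c c' x y z w =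
      del false x y z w * A + del true x y z w * B :=
    ⟨_, _, mom_AB hHaar x0 y0 h0 b b' c c'⟩
  have s1 := sum_false (μ := μ) b b' c c'
  have s2 := sum_true (μ := μ) b b' c c'
  simp only [hAB] at s1 s2
  rw [hAB x y z w]
  simp only [Finset.sum_add_distrib, ← Finset.sum_mul] at s1 s2
  have d1 : ∑ x : κ, ∑ y : κ, del false x y x y = (Fintype.card κ : ℂ) ^ 2 := by
    simp [del, sq]
  have d2 : ∑ x : κ, ∑ y : κ, del true x y x y = (Fintype.card κ : ℂ) := by
    have : ∀ x y : κ, del true x y x y = if x = y then 1 else 0 := by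
      intro x y; simp only [del, cond_true]; grind
    simp [this]
  have d3 : ∑ x : κ, ∑ y : κ, del false x y y x = (Fintype.card κ : ℂ) := by
    have : ∀ x y : κ, del false x y y x = if x = y then 1 else 0 := by
      intro x y; simp only [del, cond_false]; grind
    simp [this]
  have d4 : ∑ x : κ, ∑ y : κ, del true x y y x = (Fintype.card κ : ℂ) ^ 2 := by
    simp [del, sq]
  rw [d1, d2] at s1
  rw [d3, d4] at s2
  have hq' : (2 : ℝ) ≤ Fintype.card κ := by exact_mod_cast hq
  have n1 : (Fintype.card κ : ℂ) ≠ 0 := by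
    have : (Fintype.card κ : ℝ) ≠ 0 := by linarith
    exact_mod_cast this
  have n2 : (Fintype.card κ : ℂ)^2 - 1 ≠ 0 := by
    have : (Fintype.card κ : ℝ)^2 - 1 ≠ 0 := by nlinarith
    exact_mod_cast this
  rw [Fintype.sum_bool, Fintype.sum_bool, Fintype.sum_bool, ← s1, ← s2]
  simp only [wg, if_true, Bool.true_eq_false, Bool.false_eq_true, if_false]
  push_cast
  field_simp
  ring
end moment

section path

lemma open_path {κ R : Type*} [Fintype κ] [DecidableEq κ] [CommSemiring R] (k : ℕ)
    (M : Fin (k + 1) → Matrix κ κ R) (x y : κ) :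
    (((List.finRange (k + 1)).map M).prod) x y =
      ∑ a : Fin k → κ, ∏ m, M m ((Fin.cons x a : Fin (k + 1) → κ) m)
        ((Fin.snoc a y : Fin (k + 1) → κ) m) := by
  induction k generalizing x with
  | zero => simp [List.finRange_succ, Fin.snoc]
  | succ k ih =>
    rw [List.finRange_succ, List.map_cons, List.prod_cons, List.map_map, Matrix.mul_apply]
    rw [← (Fin.consEquiv (fun _ : Fin (k + 1) => κ)).sum_comp, Fintype.sum_prod_type]
    refine Finset.sum_congr rfl fun z _ => ?_
    have := ih (fun m => M m.succ) z
    rw [show (M ∘ Fin.succ) = fun m => M m.succ from rfl, this, Finset.mul_sum]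
    refine Finset.sum_congr rfl fun a _ => ?_
    have hc : (Fin.snoc (Fin.consEquiv (fun _ : Fin (k + 1) => κ) (z, a)) y : Fin (k + 2) → κ) =
        Fin.cons z (Fin.snoc a y : Fin (k + 1) → κ) := (Fin.cons_snoc_eq_snoc_cons z a y).symm
    rw [Fin.prod_univ_succ (n := k + 1), hc]
    simp only [Fin.consEquiv_apply, Fin.cons_zero, Fin.cons_succ]

lemma trace_path {κ R : Type*} [Fintype κ] [DecidableEq κ] [CommSemiring R] (k : ℕ)
    (M : Fin (k + 1) → Matrix κ κ R) :
    (((List.finRange (k + 1)).map M).prod).trace =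
      ∑ a : Fin (k + 1) → κ, ∏ m, M m (a m) (a (m + 1)) := by
  rw [← (Fin.consEquiv (fun _ : Fin (k + 1) => κ)).sum_comp, Fintype.sum_prod_type, Matrix.trace]
  refine Finset.sum_congr rfl fun x _ => ?_
  rw [Matrix.diag_apply, open_path]
  refine Finset.sum_congr rfl fun a _ => Finset.prod_congr rfl fun m _ => ?_
  simp only [Fin.consEquiv_apply]
  congr 1
  refine Fin.lastCases ?_ (fun m => ?_) m
  · simp
  · simp [Fin.coeSucc_eq_succ]

lemma pow_rowsum (M : Matrix Bool Bool ℝ) (s : ℝ) (h0 : ∀ i j, 0 ≤ M i j)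
    (hs : ∀ i, ∑ j, M i j = s) (n : ℕ) :
    (∀ i j, 0 ≤ (M ^ n) i j) ∧ ∀ i, ∑ j, (M ^ n) i j = s ^ n := by
  induction n with
  | zero =>
    constructor
    · intro i j
      rw [pow_zero, Matrix.one_apply]; split_ifs <;> norm_num
    · intro i; simp [Matrix.one_apply]
  | succ n ih =>
    constructor
    · intro i j
      rw [pow_succ, Matrix.mul_apply]
      exact Finset.sum_nonneg fun l _ => mul_nonneg (ih.1 _ _) (h0 _ _)
    · intro i
      simp only [pow_succ, Matrix.mul_apply]
      rw [Finset.sum_comm]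
      simp only [← Finset.mul_sum, hs, ← Finset.sum_mul, ih.2]

lemma cyc_bound (M : Bool → Bool → ℝ) (s : ℝ) (h0 : ∀ i j, 0 ≤ M i j)
    (hs : ∀ i, ∑ j, M i j = s) (k : ℕ) :
    ∑ σ : Fin (k + 1) → Bool, ∏ m, M (σ m) (σ (m + 1)) ≤ 2 * s ^ (k + 1) := by
  have h := trace_path k (fun _ : Fin (k + 1) => (Matrix.of M))
  have h2 := pow_rowsum (Matrix.of M) s h0 hs (k + 1)
  simp only [List.map_const', List.length_finRange, List.prod_replicate, Matrix.of_apply] at h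
  rw [← h, Matrix.trace]
  calc ∑ i, (Matrix.of M ^ (k + 1)).diag i ≤ ∑ i : Bool, s ^ (k + 1) := by
        refine Finset.sum_le_sum fun i _ => ?_
        rw [← h2.2 i]
        exact Finset.single_le_sum (f := fun j => (Matrix.of M ^ (k + 1)) i j)
          (fun j _ => h2.1 i j) (Finset.mem_univ i)
    _ = _ := by simp

lemma factor1 {I A : Type*} [Fintype I] [Fintype A] (F : I → ℂ) (G : A → ℂ) :
    ∑ p : I × A, F p.1 * G p.2 = (∑ i, F i) * ∑ a, G a := by
  rw [Finset.sum_mul_sum, Fintype.sum_prod_type]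

lemma factor4 {I A : Type*} [Fintype I] [Fintype A] (F : I → I → I → I → ℂ)
    (G : A → A → A → A → ℂ) :
    ∑ p : I × A, ∑ q : I × A, ∑ r : I × A, ∑ s : I × A,
      F p.1 q.1 r.1 s.1 * G p.2 q.2 r.2 s.2 =
    (∑ i, ∑ j, ∑ k, ∑ l, F i j k l) * ∑ a, ∑ b, ∑ c, ∑ e, G a b c e := by
  have h1 := fun p q r : I × A => factor1 (F p.1 q.1 r.1) (G p.2 q.2 r.2)
  have h2 := fun p q : I × A => factor1 (fun k => ∑ l, F p.1 q.1 k l) (fun c => ∑ e, G p.2 q.2 c e)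
  have h3 := fun p : I × A => factor1 (fun j => ∑ k, ∑ l, F p.1 j k l)
    (fun b => ∑ c, ∑ e, G p.2 b c e)
  have h4 := factor1 (fun i => ∑ j, ∑ k, ∑ l, F i j k l) (fun a => ∑ b, ∑ c, ∑ e, G a b c e)
  simp only [h1, h2, h3, h4]

lemma prod_sum4 {A : Type*} [Fintype A] [DecidableEq A] {n : ℕ}
    (f : Fin n → A → A → A → A → ℂ) :
    ∑ a : Fin n → A, ∑ b : Fin n → A, ∑ c : Fin n → A, ∑ e : Fin n → A,
      ∏ m, f m (a m) (b m) (c m) (e m) = ∏ m, ∑ x, ∑ y, ∑ z, ∑ w, f m x y z w := by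
  simp only [Finset.prod_univ_sum, Fintype.piFinset_univ]

end path

section purity
variable {n d : ℕ}

def mix (σ : Fin n → Bool) (i j : Fin n → Fin d) : Fin n → Fin d :=
  fun m => bif σ m then j m else i m

lemma prod_del (σ : Fin n → Bool) (i j k l : Fin n → Fin d) :
    ∏ m, del (σ m) (i m) (j m) (k m) (l m) =
      if k = mix σ i j then (if l = mix σ j i then 1 else 0) else 0 := by
  have h : ∀ m, del (σ m) (i m) (j m) (k m) (l m) =
      if (k m = mix σ i j m ∧ l m = mix σ j i m) then 1 else 0 := by
    intro m
    unfold mix del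
    cases σ m <;> simp only [cond_true, cond_false] <;> grind
  simp only [h]
  rw [Finset.prod_ite_zero]
  simp only [Finset.mem_univ, true_implies, Finset.prod_const_one, funext_iff, forall_and]
  split_ifs <;> simp_all

/-- the purity-like coefficient -/
def pur (φ : (Fin n → Fin d) → ℂ) (σ : Fin n → Bool) : ℂ :=
  ∑ i, ∑ j, ∑ k, ∑ l, (conj (φ i) * conj (φ j) * (φ k * φ l)) *
    ∏ m, del (σ m) (i m) (j m) (k m) (l m)

lemma pur_bound (φ : (Fin n → Fin d) → ℂ) (hφ : ∑ i, ‖φ i‖ ^ 2 = 1) (σ : Fin n → Bool) :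
    ‖pur φ σ‖ ≤ 1 := by
  have h1 : pur φ σ = ∑ i, ∑ j, conj (φ i) * conj (φ j) * (φ (mix σ i j) * φ (mix σ j i)) := by
    unfold pur
    refine Finset.sum_congr rfl fun i _ => Finset.sum_congr rfl fun j _ => ?_
    simp [prod_del]
  have hinv : Function.Involutive (fun p : (Fin n → Fin d) × (Fin n → Fin d) =>
      (mix σ p.1 p.2, mix σ p.2 p.1)) := by
    intro p
    ext m <;> simp only [mix] <;> cases σ m <;> simp
  let f : (Fin n → Fin d) × (Fin n → Fin d) → ℝ := fun p => ‖φ p.1‖ ^ 2 * ‖φ p.2‖ ^ 2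
  have hf : ∑ p, f p = 1 := by
    simp only [f]
    rw [Fintype.sum_prod_type]
    simp only [← Finset.mul_sum, hφ, mul_one]
  have hf2 : ∑ p : (Fin n → Fin d) × (Fin n → Fin d), f (mix σ p.1 p.2, mix σ p.2 p.1) = 1 := by
    rw [← hf]
    exact Equiv.sum_comp hinv.toPerm f
  rw [h1, ← Fintype.sum_prod_type']
  refine (norm_sum_le _ _).trans ?_
  calc _ ≤ ∑ p : (Fin n → Fin d) × (Fin n → Fin d),
        (f p + f (mix σ p.1 p.2, mix σ p.2 p.1)) / 2 := by
        refine Finset.sum_le_sum fun p _ => ?_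
        simp only [f, norm_mul, RCLike.norm_conj]
        nlinarith [sq_nonneg (‖φ p.1‖ * ‖φ p.2‖ - ‖φ (mix σ p.1 p.2)‖ * ‖φ (mix σ p.2 p.1)‖)]
    _ = 1 := by
        rw [← Finset.sum_div, Finset.sum_add_distrib, hf, hf2]; norm_num
end purity

section main
variable {d D k : ℕ} [NeZero d]

lemma del_pair {A B : Type*} [DecidableEq A] [DecidableEq B] (σ : Bool) (x y z w : A × B) :
    del σ x y z w = del σ x.1 y.1 z.1 w.1 * del σ x.2 y.2 z.2 w.2 := by
  unfold del
  cases σ <;> simp only [cond_true, cond_false, Prod.ext_iff] <;> grind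

/-- transfer matrix entry -/
def tm (q : ℝ) (D : ℕ) (σ σ' : Bool) : ℝ :=
  ∑ τ : Bool, wg q σ τ * (if τ = σ' then (D : ℝ) ^ 2 else D)

lemma sum_del (D : ℕ) (σ τ : Bool) :
    ∑ x : Fin D, ∑ y : Fin D, ∑ z : Fin D, ∑ w : Fin D, del σ x y z w * del τ x y z w =
      ((if τ = σ then (D : ℝ) ^ 2 else D : ℝ) : ℂ) := by
  cases σ <;> cases τ <;> simp [del, sq, -mul_ite, Finset.sum_mul, ← Finset.mul_sum] 

lemma tm_eq (q : ℝ) (D : ℕ) (σ σ' : Bool) :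
    ∑ x : Fin D, ∑ y : Fin D, ∑ z : Fin D, ∑ w : Fin D, del σ' x y z w *
      ∑ τ : Bool, (wg q σ τ : ℂ) * del τ x y z w = (tm q D σ σ' : ℂ) := by
  have h : ∀ x y z w : Fin D, del σ' x y z w * ∑ τ : Bool, (wg q σ τ : ℂ) * del τ x y z w =
      (wg q σ true : ℂ) * (del σ' x y z w * del true x y z w) +
      (wg q σ false : ℂ) * (del σ' x y z w * del false x y z w) := by
    intro x y z w
    rw [Fintype.sum_bool]; ring
  simp only [h]
  simp only [Finset.sum_add_distrib, ← Finset.mul_sum, sum_del, tm, Fintype.sum_bool]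
  push_cast
  rfl

/-- one term of the overlap -/
def ovTerm (φ : (Fin (k + 1) → Fin d) → ℂ)
    (p : (Fin (k + 1) → Fin d) × (Fin (k + 1) → Fin D))
    (U : Fin (k + 1) → Matrix.unitaryGroup (Fin d × Fin D) ℂ) : ℂ :=
  conj (φ p.1) * ∏ m, (U m : Matrix (Fin d × Fin D) (Fin d × Fin D) ℂ) (p.1 m, p.2 m)
    (0, p.2 (m + 1))

lemma inner_eq (φ : EuclideanSpace ℂ (Fin (k + 1) → Fin d))
    (U : Fin (k + 1) → Matrix.unitaryGroup (Fin d × Fin D) ℂ) :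
    inner ℂ φ (mpsE d D (k + 1) U) = ∑ p, ovTerm (fun i => φ i) p U := by
  rw [Fintype.sum_prod_type, PiLp.inner_apply]
  refine Finset.sum_congr rfl fun i _ => ?_
  have : (mpsE d D (k + 1) U) i = mps d D (k + 1) U i := rfl
  rw [this, mps, trace_path, RCLike.inner_apply, mul_comm]
  simp only [ovTerm, ← Finset.mul_sum]
  rfl

lemma pow_four (φ : EuclideanSpace ℂ (Fin (k + 1) → Fin d))
    (U : Fin (k + 1) → Matrix.unitaryGroup (Fin d × Fin D) ℂ) :
    ((‖(inner ℂ (mpsE d D (k + 1) U) φ : ℂ)‖ ^ 4 : ℝ) : ℂ) =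
    ∑ p : (Fin (k + 1) → Fin d) × (Fin (k + 1) → Fin D),
    ∑ q : (Fin (k + 1) → Fin d) × (Fin (k + 1) → Fin D),
    ∑ r : (Fin (k + 1) → Fin d) × (Fin (k + 1) → Fin D),
    ∑ s : (Fin (k + 1) → Fin d) × (Fin (k + 1) → Fin D),
      (conj (φ p.1) * conj (φ q.1) * (φ r.1 * φ s.1)) *
        ∏ m, quart (0, p.2 (m + 1)) (0, q.2 (m + 1)) (0, r.2 (m + 1)) (0, s.2 (m + 1))
          (p.1 m, p.2 m) (q.1 m, q.2 m) (r.1 m, r.2 m) (s.1 m, s.2 m) (U m) := by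
  rw [norm_inner_symm]
  set Z : ℂ := inner ℂ φ (mpsE d D (k + 1) U) with hZ
  have h1 : ((‖Z‖ ^ 4 : ℝ) : ℂ) = Z * (Z * (conj Z * conj Z)) := by
    have := Complex.mul_conj' Z
    push_cast
    linear_combination (-(Z * conj Z) - ‖Z‖ ^ 2) * this
  rw [h1, hZ, inner_eq, map_sum]
  simp only [Finset.sum_mul]
  refine Finset.sum_congr rfl fun p _ => ?_
  simp only [Finset.sum_mul, Finset.mul_sum]
  refine Finset.sum_congr rfl fun q _ => ?_
  rw [Finset.sum_comm]
  refine Finset.sum_congr rfl fun r _ => Finset.sum_congr rfl fun s _ => ?_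
  unfold ovTerm quart
  simp only [map_mul, map_prod, Finset.prod_mul_distrib, Complex.conj_conj]
  ring

variable (μ : Measure (Matrix.unitaryGroup (Fin d × Fin D) ℂ)) [IsProbabilityMeasure μ]

lemma expect_eq (hq : 2 ≤ d * D)
    (hHaar : ∀ V : Matrix.unitaryGroup (Fin d × Fin D) ℂ, μ.map (fun U => V * U) = μ)
    (φ : EuclideanSpace ℂ (Fin (k + 1) → Fin d)) :
    ((∫ U, ‖(inner ℂ (mpsE d D (k + 1) U) φ : ℂ)‖ ^ 4 ∂(Measure.pi fun _ : Fin (k + 1) => μ) : ℝ) : ℂ) =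
      ∑ σ : Fin (k + 1) → Bool, pur (fun i => φ i) σ *
        ((∏ m, tm ((d * D : ℕ) : ℝ) D (σ m) (σ (m + 1)) : ℝ) : ℂ) := by
  rw [← integral_complex_ofReal]
  simp only [pow_four]
  have hint : ∀ p q r s : (Fin (k + 1) → Fin d) × (Fin (k + 1) → Fin D),
      Integrable (fun U : Fin (k + 1) → Matrix.unitaryGroup (Fin d × Fin D) ℂ =>
        (conj (φ p.1) * conj (φ q.1) * (φ r.1 * φ s.1)) *
        ∏ m, quart (0, p.2 (m + 1)) (0, q.2 (m + 1)) (0, r.2 (m + 1)) (0, s.2 (m + 1))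
          (p.1 m, p.2 m) (q.1 m, q.2 m) (r.1 m, r.2 m) (s.1 m, s.2 m) (U m))
        (Measure.pi fun _ : Fin (k + 1) => μ) := by
    intro p q r s
    refine Integrable.const_mul ?_ _
    exact Integrable.fintype_prod (f := fun m => quart (0, p.2 (m + 1)) (0, q.2 (m + 1))
      (0, r.2 (m + 1)) (0, s.2 (m + 1))
          (p.1 m, p.2 m) (q.1 m, q.2 m) (r.1 m, r.2 m) (s.1 m, s.2 m))
      (fun m => quart_integrable μ _ _ _ _ _ _ _ _)
  rw [integral_finsetSum _ fun p _ => integrable_finsetSum _ fun q _ => integrable_finsetSum _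
    fun r _ => integrable_finsetSum _ fun s _ => hint p q r s]
  have step : ∀ p q r s : (Fin (k + 1) → Fin d) × (Fin (k + 1) → Fin D),
      ∫ U : Fin (k + 1) → Matrix.unitaryGroup (Fin d × Fin D) ℂ,
        (conj (φ p.1) * conj (φ q.1) * (φ r.1 * φ s.1)) *
        ∏ m, quart (0, p.2 (m + 1)) (0, q.2 (m + 1)) (0, r.2 (m + 1)) (0, s.2 (m + 1))
          (p.1 m, p.2 m) (q.1 m, q.2 m) (r.1 m, r.2 m) (s.1 m, s.2 m) (U m)
        ∂(Measure.pi fun _ : Fin (k + 1) => μ) =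
      ∑ σ : Fin (k + 1) → Bool, ((conj (φ p.1) * conj (φ q.1) * (φ r.1 * φ s.1)) *
        ∏ m, del (σ m) (p.1 m) (q.1 m) (r.1 m) (s.1 m)) *
        ∏ m, (del (σ (m + 1)) (p.2 (m + 1)) (q.2 (m + 1)) (r.2 (m + 1)) (s.2 (m + 1)) *
          ∑ τ : Bool, (wg ((d * D : ℕ) : ℝ) (σ m) τ : ℂ) *
            del τ (p.2 (m + 1)) (q.2 (m + 1)) (r.2 (m + 1)) (s.2 (m + 1))) := by
    intro p q r s
    rw [integral_const_mul]
    have e := integral_fintype_prod_eq_prod (μ := fun _ : Fin (k + 1) => μ)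
      (fun m => quart (0, p.2 (m + 1)) (0, q.2 (m + 1)) (0, r.2 (m + 1)) (0, s.2 (m + 1))
          (p.1 m, p.2 m) (q.1 m, q.2 m) (r.1 m, r.2 m) (s.1 m, s.2 m))
    rw [e]
    have hm : ∀ m, ∫ U, quart (0, p.2 (m + 1)) (0, q.2 (m + 1)) (0, r.2 (m + 1)) (0, s.2 (m + 1))
          (p.1 m, p.2 m) (q.1 m, q.2 m) (r.1 m, r.2 m) (s.1 m, s.2 m) U ∂μ =
          ∑ σ : Bool, del σ (p.1 m) (q.1 m) (r.1 m) (s.1 m) * del σ (p.2 m) (q.2 m) (r.2 m) (s.2 m) *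
            ∑ τ : Bool, (wg ((d * D : ℕ) : ℝ) σ τ : ℂ) *
            del τ (p.2 (m + 1)) (q.2 (m + 1)) (r.2 (m + 1)) (s.2 (m + 1)) := by
      intro m
      have := mom_formula hHaar (by simpa using hq) (0, p.2 (m + 1)) (0, q.2 (m + 1))
        (0, r.2 (m + 1)) (0, s.2 (m + 1))
          (p.1 m, p.2 m) (q.1 m, q.2 m) (r.1 m, r.2 m) (s.1 m, s.2 m)
      unfold mom at this
      rw [this]
      have d0 : ∀ τ, del τ (0 : Fin d) 0 0 0 = 1 := by intro τ; cases τ <;> simp [del]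
      simp only [del_pair, Fintype.card_prod, Fintype.card_fin, d0, one_mul]
    simp only [hm]
    rw [Finset.prod_univ_sum, Fintype.piFinset_univ, Finset.mul_sum]
    refine Finset.sum_congr rfl fun σ _ => ?_
    simp only [Finset.prod_mul_distrib]
    have hs : ∏ m, del (σ (m + 1)) (p.2 (m + 1)) (q.2 (m + 1)) (r.2 (m + 1)) (s.2 (m + 1)) =
        ∏ m, del (σ m) (p.2 m) (q.2 m) (r.2 m) (s.2 m) :=
      Equiv.prod_comp (Equiv.addRight (1 : Fin (k + 1)))
        (fun m => del (σ m) (p.2 m) (q.2 m) (r.2 m) (s.2 m))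
    rw [hs]
    ring
  have step2 : ∀ p : (Fin (k + 1) → Fin d) × (Fin (k + 1) → Fin D),
      ∫ U : Fin (k + 1) → Matrix.unitaryGroup (Fin d × Fin D) ℂ,
      ∑ q : (Fin (k + 1) → Fin d) × (Fin (k + 1) → Fin D),
      ∑ r : (Fin (k + 1) → Fin d) × (Fin (k + 1) → Fin D),
      ∑ s : (Fin (k + 1) → Fin d) × (Fin (k + 1) → Fin D),
        (conj (φ p.1) * conj (φ q.1) * (φ r.1 * φ s.1)) *
        ∏ m, quart (0, p.2 (m + 1)) (0, q.2 (m + 1)) (0, r.2 (m + 1)) (0, s.2 (m + 1))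
          (p.1 m, p.2 m) (q.1 m, q.2 m) (r.1 m, r.2 m) (s.1 m, s.2 m) (U m)
        ∂(Measure.pi fun _ : Fin (k + 1) => μ) = 
      ∑ σ : Fin (k + 1) → Bool, ∑ q : (Fin (k + 1) → Fin d) × (Fin (k + 1) → Fin D),
      ∑ r : (Fin (k + 1) → Fin d) × (Fin (k + 1) → Fin D),
      ∑ s : (Fin (k + 1) → Fin d) × (Fin (k + 1) → Fin D),
      ((conj (φ p.1) * conj (φ q.1) * (φ r.1 * φ s.1)) *
        ∏ m, del (σ m) (p.1 m) (q.1 m) (r.1 m) (s.1 m)) *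
        ∏ m, (del (σ (m + 1)) (p.2 (m + 1)) (q.2 (m + 1)) (r.2 (m + 1)) (s.2 (m + 1)) *
          ∑ τ : Bool, (wg ((d * D : ℕ) : ℝ) (σ m) τ : ℂ) *
            del τ (p.2 (m + 1)) (q.2 (m + 1)) (r.2 (m + 1)) (s.2 (m + 1))) := by
    intro p
    rw [integral_finsetSum _ fun q _ => integrable_finsetSum _
      fun r _ => integrable_finsetSum _ fun s _ => hint p q r s, Finset.sum_comm]
    refine Finset.sum_congr rfl fun q _ => ?_
    rw [integral_finsetSum _ fun r _ => integrable_finsetSum _ fun s _ => hint p q r s,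
      Finset.sum_comm]
    refine Finset.sum_congr rfl fun r _ => ?_
    rw [integral_finsetSum _ fun s _ => hint p q r s, Finset.sum_comm]
    exact Finset.sum_congr rfl fun s _ => step p q r s
  simp only [step2]
  rw [Finset.sum_comm]
  refine Finset.sum_congr rfl fun σ _ => ?_
  refine (factor4 (fun i j i' j' : Fin (k + 1) → Fin d => (conj (φ i) * conj (φ j) * (φ i' * φ j')) *
        ∏ m, del (σ m) (i m) (j m) (i' m) (j' m))
      (fun a b c e : Fin (k + 1) → Fin D => ∏ m, (del (σ (m + 1)) (a (m + 1)) (b (m + 1)) (c (m + 1)) (e (m + 1)) *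
          ∑ τ : Bool, (wg ((d * D : ℕ) : ℝ) (σ m) τ : ℂ) *
            del τ (a (m + 1)) (b (m + 1)) (c (m + 1)) (e (m + 1))))).trans ?_
  unfold pur
  congr 1
  have hshift : ∀ a b c e : Fin (k + 1) → Fin D,
      ∏ m, (del (σ (m + 1)) (a (m + 1)) (b (m + 1)) (c (m + 1)) (e (m + 1)) *
          ∑ τ : Bool, (wg ((d * D : ℕ) : ℝ) (σ m) τ : ℂ) *
            del τ (a (m + 1)) (b (m + 1)) (c (m + 1)) (e (m + 1))) =
      ∏ m, (del (σ m) (a m) (b m) (c m) (e m) *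
          ∑ τ : Bool, (wg ((d * D : ℕ) : ℝ) (σ (m - 1)) τ : ℂ) *
            del τ (a m) (b m) (c m) (e m)) := by
    intro a b c e
    conv_rhs => rw [← Equiv.prod_comp (Equiv.addRight (1 : Fin (k + 1)))]
    refine Finset.prod_congr rfl fun m _ => ?_
    simp only [Equiv.coe_addRight, add_sub_cancel_right]
  simp only [hshift]
  rw [prod_sum4 (fun m x y z w => del (σ m) x y z w *
          ∑ τ : Bool, (wg ((d * D : ℕ) : ℝ) (σ (m - 1)) τ : ℂ) * del τ x y z w)]
  simp only [tm_eq]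
  rw [← Equiv.prod_comp (Equiv.addRight (1 : Fin (k + 1)))]
  push_cast
  refine Finset.prod_congr rfl fun m _ => ?_
  simp only [Equiv.coe_addRight, add_sub_cancel_right]

end main

/-- for `d, D ≥ 2` and
`α(d,D) = log((d − 1/(dD²))/((1 + 1/D)(1 + 1/(dD))))`, for every orthonormal basis
`{φ_j}` of `(ℂ^d)^{⊗n}` the expected inverse effective dimension of a random MPS
satisfies `E Σ_j |⟨ψ|φ_j⟩|⁴ ≤ 2 e^{−α(d,D) n}`.  The site unitaries are drawn i.i.d.
from the Haar probability measure on `U(dD)` (the unique left-invariant Borel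
probability measure). -/
theorem expected_inverse_effective_dimension
    (d D n : ℕ) [NeZero d] (hd : 2 ≤ d) (hD : 2 ≤ D) (hn : 1 ≤ n)
    (μ : Measure (Matrix.unitaryGroup (Fin d × Fin D) ℂ)) [IsProbabilityMeasure μ]
    (hHaar : ∀ V : Matrix.unitaryGroup (Fin d × Fin D) ℂ, μ.map (fun U => V * U) = μ)
    (ι : Type) [Fintype ι] (b : OrthonormalBasis ι ℂ (EuclideanSpace ℂ (Fin n → Fin d))) :
    ∫ U, ∑ j : ι, ‖(inner ℂ (mpsE d D n U) (b j) : ℂ)‖ ^ 4 ∂(Measure.pi fun _ : Fin n => μ)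
      ≤ 2 * Real.exp (-(Real.log (((d : ℝ) - 1 / ((d : ℝ) * (D : ℝ) ^ 2)) /
          ((1 + 1 / (D : ℝ)) * (1 + 1 / ((d : ℝ) * (D : ℝ))))) * n)) := by
  obtain ⟨k, rfl⟩ : ∃ k, n = k + 1 := ⟨n - 1, by omega⟩
  have hd' : (2 : ℝ) ≤ d := by exact_mod_cast hd
  have hD' : (2 : ℝ) ≤ D := by exact_mod_cast hD
  have hq : 2 ≤ d * D := by nlinarith
  have hqR : (4 : ℝ) ≤ d * D := by nlinarith
  have q1 : (0 : ℝ) < (d * D : ℝ) - 1 := by linarith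
  have q2 : (0 : ℝ) < (d * D : ℝ) ^ 2 - 1 := by nlinarith
  set s : ℝ := ((D : ℝ) ^ 2 + D) / (d * D * (d * D + 1)) with hs
  have hwg1 : ∀ σ : Bool, wg ((d * D : ℕ) : ℝ) σ σ = 1 / ((d * D : ℝ) ^ 2 - 1) := by
    intro σ; simp [wg]
  have tnn : ∀ i j, 0 ≤ tm ((d * D : ℕ) : ℝ) D i j := by
    have e1 : tm ((d * D : ℕ) : ℝ) D true true =
        ((D : ℝ) ^ 2 * (d * D) - D) / (d * D * ((d * D : ℝ) ^ 2 - 1)) := by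
      simp [tm, wg]; field_simp; ring
    have e2 : tm ((d * D : ℕ) : ℝ) D true false =
        ((D : ℝ) * (d * D) - D ^ 2) / (d * D * ((d * D : ℝ) ^ 2 - 1)) := by
      simp [tm, wg]; field_simp; ring
    have e3 : tm ((d * D : ℕ) : ℝ) D false false = tm ((d * D : ℕ) : ℝ) D true true := by
      simp [tm, wg]; ring
    have e4 : tm ((d * D : ℕ) : ℝ) D false true = tm ((d * D : ℕ) : ℝ) D true false := by
      simp [tm, wg]; ring
    have f1 : 0 ≤ tm ((d * D : ℕ) : ℝ) D true true := by
      rw [e1]; apply div_nonneg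
      · nlinarith
      · positivity
    have f2 : 0 ≤ tm ((d * D : ℕ) : ℝ) D true false := by
      rw [e2]; apply div_nonneg
      · nlinarith [mul_pos (show (0:ℝ) < D by linarith) (show (0:ℝ) < D by linarith)]
      · positivity
    intro i j
    cases i <;> cases j <;> simp only [e3, e4, f1, f2]
  have trow : ∀ i, ∑ j, tm ((d * D : ℕ) : ℝ) D i j = s := by
    have q3 : (d * D : ℝ) ^ 2 - 1 = (d * D - 1) * (d * D + 1) := by ring
    intro i
    cases i <;> simp [tm, wg, hs] <;> rw [q3] <;> field_simp <;> ring
  have hcyc := cyc_bound (tm ((d * D : ℕ) : ℝ) D) s tnn trow k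
  have hj : ∀ j, ∫ U, ‖(inner ℂ (mpsE d D (k + 1) U) (b j) : ℂ)‖ ^ 4
      ∂(Measure.pi fun _ : Fin (k + 1) => μ) ≤ 2 * s ^ (k + 1) := by
    intro j
    refine le_trans ?_ hcyc
    have h := expect_eq μ hq hHaar (b j)
    have hφ : ∑ i, ‖(b j) i‖ ^ 2 = 1 := by
      rw [← EuclideanSpace.norm_sq_eq, b.norm_eq_one]; norm_num
    refine (le_abs_self _).trans ?_
    rw [← Real.norm_eq_abs, ← Complex.norm_real, h]
    refine (norm_sum_le _ _).trans (Finset.sum_le_sum fun σ _ => ?_)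
    rw [norm_mul, Complex.norm_real, Real.norm_of_nonneg (Finset.prod_nonneg fun m _ => tnn _ _)]
    exact mul_le_of_le_one_left (Finset.prod_nonneg fun m _ => tnn _ _) (pur_bound _ hφ σ)
  have hint : ∀ j, Integrable (fun U => ‖(inner ℂ (mpsE d D (k + 1) U) (b j) : ℂ)‖ ^ 4)
      (Measure.pi fun _ : Fin (k + 1) => μ) := by
    intro j
    have : Integrable (fun U => ((‖(inner ℂ (mpsE d D (k + 1) U) (b j) : ℂ)‖ ^ 4 : ℝ) : ℂ))
      (Measure.pi fun _ : Fin (k + 1) => μ) := by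
      simp only [pow_four]
      refine integrable_finsetSum _ fun p _ => integrable_finsetSum _ fun q _ =>
        integrable_finsetSum _ fun r _ => integrable_finsetSum _ fun s _ => ?_
      refine Integrable.const_mul ?_ _
      exact Integrable.fintype_prod (f := fun m => quart (0, p.2 (m + 1)) (0, q.2 (m + 1))
        (0, r.2 (m + 1)) (0, s.2 (m + 1))
          (p.1 m, p.2 m) (q.1 m, q.2 m) (r.1 m, r.2 m) (s.1 m, s.2 m))
        (fun m => quart_integrable μ _ _ _ _ _ _ _ _)
    exact this.re
  have hcard : Fintype.card ι = d ^ (k + 1) := by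
    have h1 := Module.finrank_eq_card_basis b.toBasis
    rw [← h1, finrank_euclideanSpace]
    simp
  rw [integral_finsetSum _ fun j _ => hint j]
  calc _ ≤ ∑ j : ι, 2 * s ^ (k + 1) := Finset.sum_le_sum fun j _ => hj j
    _ = 2 * (d * s) ^ (k + 1) := by
      rw [Finset.sum_const, Finset.card_univ, hcard, nsmul_eq_mul, mul_pow]
      push_cast; ring
    _ ≤ _ := by
      have hX : (0 : ℝ) < (((d : ℝ) - 1 / ((d : ℝ) * (D : ℝ) ^ 2)) /
          ((1 + 1 / (D : ℝ)) * (1 + 1 / ((d : ℝ) * (D : ℝ))))) := by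
        have : 1 / ((d : ℝ) * (D : ℝ) ^ 2) < 1 := by
          rw [div_lt_one (by positivity)]; nlinarith
        apply div_pos
        · linarith
        · positivity
      rw [← neg_mul, mul_comm (-_) ((k + 1 : ℕ) : ℝ), Real.exp_nat_mul, Real.exp_neg, Real.exp_log hX]
      gcongr
      have e1 : (d : ℝ) * s = (D + 1) / (d * D + 1) := by
        rw [hs]; field_simp
      have e2 : ((((d : ℝ) - 1 / ((d : ℝ) * (D : ℝ) ^ 2)) /
          ((1 + 1 / (D : ℝ)) * (1 + 1 / ((d : ℝ) * (D : ℝ))))))⁻¹ = ((D : ℝ) + 1) / ((d : ℝ) * D - 1) := by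
        have : (d : ℝ) - 1 / ((d : ℝ) * (D : ℝ) ^ 2) =
            (d * D - 1) * (d * D + 1) / ((d : ℝ) * (D : ℝ) ^ 2) := by
          field_simp; ring
        rw [this]; field_simp
      rw [e1, e2]
      gcongr
      linarith
end
end
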